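/- Let G be a finite regular simple graph with at least one edge and let s ≥ 3 be an integer. Then: (i) the palette index of the Cartesian product P_s □ G is at most š(G) + 2; (ii) if s is even or G is class 1, then the palette index of P_s □ G equals 2; (iii) if G is a class 2 cubic (3-regular) graph possessing a perfect matching and s is odd, then the palette index of P_s □ G belongs to {2, 3, 4}. -/

import Mathlib

open SimpleGraph

/-- A proper edge coloring of `G` (colors in `ℕ`): distinct edges sharing a
vertex receive different colors. -/
def IsProperEdgeColoring {V : Type*} (G : SimpleGraph V) (f : Sym2 V → ℕ) : Prop :=
  ∀ e₁ ∈ G.edgeSet, ∀ e₂ ∈ G.edgeSet, e₁ ≠ e₂ → (∃ v, v ∈ e₁ ∧ v ∈ e₂) → f e₁ ≠ f e₂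

/-- The palette of a vertex `v` under an edge coloring `f`: the set of colors
assigned to the edges incident to `v`. -/
def palette {V : Type*} (G : SimpleGraph V) (f : Sym2 V → ℕ) (v : V) : Set ℕ :=
  {c | ∃ e ∈ G.edgeSet, v ∈ e ∧ f e = c}

/-- The number of distinct palettes of vertices of `G` with respect to `f`. -/
noncomputable def numPalettes {V : Type*} (G : SimpleGraph V) (f : Sym2 V → ℕ) : ℕ :=
  (Set.range (palette G f)).ncard

/-- The palette index `š(G)`: the minimum number of distinct vertex palettes
over all proper edge colorings of `G`. -/
noncomputable def paletteIndex {V : Type*} (G : SimpleGraph V) : ℕ :=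
  sInf {n | ∃ f, IsProperEdgeColoring G f ∧ numPalettes G f = n}

/-- The chromatic index `χ'(G)`: the minimum `n` such that `G` has a proper
edge coloring with colors from `{0, …, n-1}`. -/
noncomputable def chromIndex {V : Type*} (G : SimpleGraph V) : ℕ :=
  sInf {n | ∃ f, IsProperEdgeColoring G f ∧ ∀ e ∈ G.edgeSet, f e < n}

/-- The degree of a vertex. -/
noncomputable def vertDegree {V : Type*} (G : SimpleGraph V) (v : V) : ℕ :=
  (G.neighborSet v).ncard

/-- The maximum degree `Δ(G)`. -/
noncomputable def maxDeg {V : Type*} (G : SimpleGraph V) : ℕ :=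
  sSup (Set.range (vertDegree G))

/-- `G` is class 1 if `χ'(G) = Δ(G)`. -/
def IsClass1 {V : Type*} (G : SimpleGraph V) : Prop := chromIndex G = maxDeg G

/-- `G` is `r`-regular. -/
def IsRegularDeg {V : Type*} (G : SimpleGraph V) (r : ℕ) : Prop :=
  ∀ v, vertDegree G v = r

/-- A perfect matching: a set `M` of edges of `G` such that every vertex is
incident to exactly one edge of `M`. -/
def IsPerfectMatchingSet {V : Type*} (G : SimpleGraph V) (M : Set (Sym2 V)) : Prop :=
  M ⊆ G.edgeSet ∧ ∀ v : V, ∃! e, e ∈ M ∧ v ∈ e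

open Classical in
theorem three_ends {V : Type*} [Fintype V] (K : SimpleGraph V)
    (h2 : ∀ v, (K.neighborSet v).ncard ≤ 2) {u v w : V} (huv : u ≠ v) (huw : u ≠ w) (hvw : v ≠ w)
    (hu : (K.neighborSet u).ncard ≤ 1) (hv : (K.neighborSet v).ncard ≤ 1)
    (hw : (K.neighborSet w).ncard ≤ 1) (ruv : K.Reachable u v) (ruw : K.Reachable u w) : False := by
  let C := K.connectedComponentMk u
  have hC : C.toSimpleGraph.Connected := C.connected_toSimpleGraph
  have h1 := hC.card_vert_le_card_edgeSet_add_one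
  have hdeg : ∀ x : C, C.toSimpleGraph.degree x ≤ (K.neighborSet x.1).ncard := by
    intro x
    rw [← SimpleGraph.card_neighborFinset_eq_degree, ← Set.ncard_coe_finset]
    rw [← Set.ncard_image_of_injective _ (Subtype.val_injective)]
    apply Set.ncard_le_ncard _ (Set.toFinite _)
    rintro _ ⟨y, hy, rfl⟩
    simp only [SimpleGraph.coe_neighborFinset, SimpleGraph.mem_neighborSet] at hy ⊢
    exact hy
  have hsum := C.toSimpleGraph.sum_degrees_eq_twice_card_edges
  let u' : C := ⟨u, SimpleGraph.ConnectedComponent.connectedComponentMk_mem⟩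
  let v' : C := ⟨v, SimpleGraph.ConnectedComponent.sound ruv.symm⟩
  let w' : C := ⟨w, SimpleGraph.ConnectedComponent.sound ruw.symm⟩
  have hle : ∑ x : C, C.toSimpleGraph.degree x + ∑ x : C, (if x = u' then 1 else 0)
     + ∑ x : C, (if x = v' then 1 else 0) + ∑ x : C, (if x = w' then 1 else 0) ≤ ∑ x : C, 2 := by
    rw [← Finset.sum_add_distrib, ← Finset.sum_add_distrib, ← Finset.sum_add_distrib]
    apply Finset.sum_le_sum
    intro x _
    have a := hdeg x
    have b := h2 x.1
    have e1 : u' ≠ v' := fun h => huv (congrArg Subtype.val h)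
    have e2 : u' ≠ w' := fun h => huw (congrArg Subtype.val h)
    have e3 : v' ≠ w' := fun h => hvw (congrArg Subtype.val h)
    by_cases c1 : x = u'
    · subst c1
      simp only [if_true, if_neg e1, if_neg e2]
      have : C.toSimpleGraph.degree u' ≤ 1 := a.trans hu
      omega
    by_cases c2 : x = v'
    · subst c2
      simp only [if_true, if_neg e1.symm, if_neg e3]
      have : C.toSimpleGraph.degree v' ≤ 1 := a.trans hv
      omega
    by_cases c3 : x = w'
    · subst c3
      simp only [if_true, if_neg e2.symm, if_neg e3.symm]
      have : C.toSimpleGraph.degree w' ≤ 1 := a.trans hw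
      omega
    simp only [if_neg c1, if_neg c2, if_neg c3]
    omega
  simp only [Finset.sum_ite_eq', Finset.mem_univ, if_true, Finset.sum_const, Finset.card_univ,
    smul_eq_mul] at hle
  rw [Nat.card_eq_fintype_card, Nat.card_eq_fintype_card, ← SimpleGraph.edgeFinset_card] at h1
  omega

/-- Symmetric two-variable form of a proper edge coloring. -/
def PC {V : Type*} (G : SimpleGraph V) (c : V → V → ℕ) : Prop :=
  (∀ u v, c u v = c v u) ∧ ∀ v u w, G.Adj v u → G.Adj v w → c v u = c v w → u = w

/-- The palette in two-variable form. -/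
def pal {V : Type*} (G : SimpleGraph V) (c : V → V → ℕ) (v : V) : Set ℕ :=
  {k | ∃ u, G.Adj v u ∧ c v u = k}

open Classical in
/-- Kempe swap on a closed set of vertices -/
theorem kempe {V : Type*} (G : SimpleGraph V) (c : V → V → ℕ) (hc : PC G c) (a b : ℕ)
    (S : Set V) (hS : ∀ u v, G.Adj u v → (c u v = a ∨ c u v = b) → u ∈ S → v ∈ S) :
    ∃ c', PC G c' ∧ (∀ v ∉ S, ∀ u, G.Adj v u → c' v u = c v u) ∧
      (∀ v ∈ S, ∀ u, G.Adj v u → c' v u = Equiv.swap a b (c v u)) := by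
  have key : ∀ v ∉ S, ∀ u, G.Adj v u → u ∈ S → Equiv.swap a b (c v u) = c v u := by
    intro v hv u hvu hu
    apply Equiv.swap_apply_of_ne_of_ne
    · intro h; exact hv (hS u v hvu.symm (by rw [hc.1]; exact Or.inl h) hu)
    · intro h; exact hv (hS u v hvu.symm (by rw [hc.1]; exact Or.inr h) hu)
  have o1 : ∀ v ∉ S, ∀ u, G.Adj v u →
      (if v ∈ S ∨ u ∈ S then Equiv.swap a b (c v u) else c v u) = c v u := by
    intro v hv u hvu
    by_cases hu : u ∈ S
    · simp [hu, key v hv u hvu hu]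
    · simp [hu, hv]
  have o2 : ∀ v ∈ S, ∀ u, G.Adj v u →
      (if v ∈ S ∨ u ∈ S then Equiv.swap a b (c v u) else c v u) = Equiv.swap a b (c v u) := by
    intro v hv u hvu
    simp [hv]
  refine ⟨fun u v => if u ∈ S ∨ v ∈ S then Equiv.swap a b (c u v) else c u v, ⟨?_, ?_⟩, o1, o2⟩
  · intro u v; simp only [hc.1 u v, or_comm]
  · intro v u w hu hw h
    simp only at h
    by_cases hv : v ∈ S
    · rw [o2 v hv u hu, o2 v hv w hw] at h
      exact hc.2 v u w hu hw ((Equiv.swap a b).injective h)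
    · rw [o1 v hv u hu, o1 v hv w hw] at h
      exact hc.2 v u w hu hw h

/-- `G` minus the edge `xy`. -/
def delE {V : Type*} (G : SimpleGraph V) (x y : V) : SimpleGraph V where
  Adj u v := G.Adj u v ∧ ¬ (u = x ∧ v = y) ∧ ¬ (u = y ∧ v = x)
  symm := ⟨fun u v h => ⟨h.1.symm, fun e => h.2.2 ⟨e.2, e.1⟩, fun e => h.2.1 ⟨e.2, e.1⟩⟩⟩
  loopless := ⟨fun u h => h.1.ne rfl⟩

/-- The two-colored graph on `G - x`. -/
def twoCol {V : Type*} (G : SimpleGraph V) (c : V → V → ℕ) (hc : ∀ u v, c u v = c v u) (x : V)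
    (a b : ℕ) : SimpleGraph V where
  Adj u v := G.Adj u v ∧ u ≠ x ∧ v ≠ x ∧ (c u v = a ∨ c u v = b)
  symm := ⟨fun u v h => ⟨h.1.symm, h.2.2.1, h.2.1, by rw [hc]; exact h.2.2.2⟩⟩
  loopless := ⟨fun u h => h.1.ne rfl⟩

open Classical in
theorem color_edge {V : Type*} (G : SimpleGraph V) (x y : V) (c : V → V → ℕ)
    (hc : PC (delE G x y) c) (d a : ℕ) (hd : ∀ u v, (delE G x y).Adj u v → c u v ≤ d) (ha : a ≤ d)
    (hx : ∀ u, (delE G x y).Adj x u → c x u ≠ a) (hy : ∀ u, (delE G x y).Adj y u → c y u ≠ a) :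
    ∃ c', PC G c' ∧ ∀ u v, G.Adj u v → c' u v ≤ d := by
  let P : V → V → Prop := fun u v => (u = x ∧ v = y) ∨ (u = y ∧ v = x)
  have hP : ∀ u v, P u v ↔ P v u := by intro u v; simp only [P]; tauto
  have hA : ∀ u v, G.Adj u v → ¬ P u v → (delE G x y).Adj u v := by
    intro u v h hp; simp only [P, not_or] at hp; exact ⟨h, hp.1, hp.2⟩
  have hm : ∀ v u w, P v u → (delE G x y).Adj v w → c v w ≠ a := by
    rintro v u w (⟨rfl, rfl⟩ | ⟨rfl, rfl⟩) h
    · exact hx _ h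
    · exact hy _ h
  refine ⟨fun u v => if P u v then a else c u v, ⟨?_, ?_⟩, ?_⟩
  · intro u v; simp only [hP u v, hc.1 u v]
  · intro v u w hu hw h
    simp only at h
    by_cases p1 : P v u <;> by_cases p2 : P v w
    · rcases p1 with ⟨h1, h2⟩ | ⟨h1, h2⟩ <;> rcases p2 with ⟨h3, h4⟩ | ⟨h3, h4⟩ <;> grind
    · simp only [p1, p2, if_true, if_false] at h
      exact absurd h.symm (hm v u w p1 (hA _ _ hw p2))
    · simp only [p1, p2, if_true, if_false] at h
      exact absurd h (hm v w u p2 (hA _ _ hu p1))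
    · simp only [p1, p2, if_false] at h
      exact hc.2 v u w (hA _ _ hu p1) (hA _ _ hw p2) h
  · intro u v h
    by_cases p : P u v
    · simp [p, ha]
    · simp only [p, if_false]; exact hd _ _ (hA _ _ h p)

theorem kempe_claim {V : Type*} (G : SimpleGraph V) (d : ℕ) (x y : V) (hxy : G.Adj x y)
    (hno : ¬ ∃ c', PC G c' ∧ ∀ u v, G.Adj u v → c' u v ≤ d)
    (c : V → V → ℕ) (hc : PC (delE G x y) c) (hd : ∀ u v, (delE G x y).Adj u v → c u v ≤ d)
    (a b : ℕ) (ha : a ≤ d) (hb : b ≤ d)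
    (hx : ∀ u, (delE G x y).Adj x u → c x u ≠ a) (hy : ∀ u, (delE G x y).Adj y u → c y u ≠ b) :
    ∃ z, (delE G x y).Adj x z ∧ c x z = b ∧ (twoCol G c hc.1 x a b).Reachable y z := by
  by_contra hcon
  push Not at hcon
  let S : Set V := {v | (twoCol G c hc.1 x a b).Reachable y v}
  have hxS : x ∉ S := by
    intro h
    obtain ⟨p⟩ := h
    cases hp : p.reverse with
    | nil => exact hxy.ne rfl
    | cons h _ => exact h.2.1 rfl
  have hyS : y ∈ S := SimpleGraph.Reachable.refl _
  obtain ⟨c', h1, h2, h3⟩ := kempe (delE G x y) c hc a b S (by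
    intro u v huv hcol hu
    have hux : u ≠ x := fun h => hxS (h ▸ hu)
    by_cases hvx : v = x
    · subst hvx
      exfalso
      rw [hc.1] at hcol
      rcases hcol with h | h
      · exact hx u huv.symm h
      · exact hcon u huv.symm h hu
    · exact SimpleGraph.Reachable.trans hu (SimpleGraph.Adj.reachable ⟨huv.1, hux, hvx, hcol⟩))
  apply hno
  refine color_edge G x y c' h1 d a ?_ ha ?_ ?_
  · intro u v huv
    by_cases hu : u ∈ S
    · rw [h3 u hu v huv]
      have := hd u v huv
      rw [Equiv.swap_apply_def]; split_ifs <;> omega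
    · rw [h2 u hu v huv]; exact hd u v huv
  · intro u hu; rw [h2 x hxS u hu]; exact hx u hu
  · intro u hu h
    rw [h3 y hyS u hu] at h
    apply hy u hu
    have := congrArg (Equiv.swap a b) h
    simpa using this

open Classical in
theorem exists_missing {V : Type*} [Fintype V] (G : SimpleGraph V) (c : V → V → ℕ) (d : ℕ)
    (v : V) (hv : (G.neighborSet v).ncard ≤ d) : ∃ b ≤ d, ∀ u, G.Adj v u → c v u ≠ b := by
  by_contra hcon
  push Not at hcon
  have : (Set.Iic d) ⊆ c v '' G.neighborSet v := by
    intro b hb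
    obtain ⟨u, h1, h2⟩ := hcon b hb
    exact ⟨u, h1, h2⟩
  have h1 := Set.ncard_le_ncard this (Set.toFinite _)
  have h2 := Set.ncard_image_le (f := c v) (Set.toFinite (G.neighborSet v))
  have h3 : (Set.Iic d).ncard = d + 1 := by
    rw [← Finset.coe_Iic, Set.ncard_coe_finset]; simp
  omega

theorem delE_le {V : Type*} (G : SimpleGraph V) (x y : V) (v : V) [Fintype V] :
    ((delE G x y).neighborSet v).ncard ≤ (G.neighborSet v).ncard :=
  Set.ncard_le_ncard (fun _ h => h.1) (Set.toFinite _)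

open Classical in
theorem vizing_step {V : Type*} [Fintype V] (G : SimpleGraph V) (d : ℕ)
    (hdeg : ∀ v, (G.neighborSet v).ncard ≤ d) (x y0 : V) (hxy : G.Adj x y0)
    (c : V → V → ℕ) (hc : PC (delE G x y0) c) (hd : ∀ u v, (delE G x y0).Adj u v → c u v ≤ d) :
    ∃ c', PC G c' ∧ ∀ u v, G.Adj u v → c' u v ≤ d := by
  by_contra hno
  have hmiss := fun v => exists_missing (delE G x y0) c d v ((delE_le G x y0 v).trans (hdeg v))
  choose b hb hbm using hmiss
  set a := b x with ha
  -- fans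
  let Fan : ℕ → (ℕ → V) → Prop := fun k y => Set.InjOn y (Set.Iic k) ∧ (∀ i ≤ k, G.Adj x (y i)) ∧
    y 0 = y0 ∧ ∀ i < k, c x (y (i+1)) = b (y i)
  -- shifted colorings
  let sh : (ℕ → V) → ℕ → V → V → ℕ := fun y i u v =>
    if u = x ∧ (∃ l < i, v = y l) then b v else if v = x ∧ (∃ l < i, u = y l) then b u else c u v
  have sh_x : ∀ k y, Fan k y → ∀ i ≤ k, ∀ l < i, sh y i x (y l) = b (y l) := by
    intro k y _ i _ l hl
    exact if_pos ⟨rfl, l, hl, rfl⟩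
  have sh_x' : ∀ k y, Fan k y → ∀ i ≤ k, ∀ v, v ≠ x → (∀ l < i, v ≠ y l) → sh y i x v = c x v := by
    intro k y _ i _ v hv hl
    simp only [sh]; rw [if_neg (by rintro ⟨_, l, h1, h2⟩; exact hl l h1 h2), if_neg (by tauto)]
  have sh_o : ∀ y i u v, u ≠ x → v ≠ x → sh y i u v = c u v := by
    intro y i u v hu hv
    simp only [sh]; rw [if_neg (by tauto), if_neg (by tauto)]
  have sh_symm : ∀ k y, Fan k y → ∀ i ≤ k, ∀ u v, sh y i u v = sh y i v u := by
    intro k y hF i hi u v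
    by_cases hu : u = x <;> by_cases hv : v = x
    · rw [hu, hv]
    · simp only [sh, hu, hv, true_and, false_and, if_false, hc.1 x v]
    · simp only [sh, hu, hv, true_and, false_and, if_false, hc.1 u x]
    · rw [sh_o _ _ _ _ hu hv, sh_o _ _ _ _ hv hu, hc.1]
  -- adjacency at x in G - x y_i of a vertex that is not among the y_l (l ≤ i)
  have adj0 : ∀ u, G.Adj x u → u ≠ y0 → (delE G x y0).Adj x u := by
    intro u h1 h2
    exact ⟨h1, fun e => h2 e.2, fun e => hxy.ne e.1⟩
  have adjo : ∀ u v, G.Adj u v → u ≠ x → v ≠ x → (delE G x y0).Adj u v := by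
    intro u v h1 h2 h3
    exact ⟨h1, fun e => h2 e.1, fun e => h3 e.2⟩
  have adjfan : ∀ k y, Fan k y → ∀ i ≤ k, 0 < i → (delE G x y0).Adj x (y i) := by
    intro k y hF i hi h0
    refine adj0 _ (hF.2.1 i hi) ?_
    intro e
    rw [← hF.2.2.1] at e
    have := hF.1 (show i ∈ Set.Iic k from hi) (show 0 ∈ Set.Iic k by simp) e
    omega
  -- colours at x under sh
  have case_x : ∀ k y, Fan k y → ∀ i ≤ k, ∀ u, (delE G x (y i)).Adj x u →
      (∃ l < i, u = y l ∧ sh y i x u = b (y l) ∧ c x (y (l+1)) = b (y l)) ∨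
      ((∀ l ≤ i, u ≠ y l) ∧ sh y i x u = c x u ∧ (delE G x y0).Adj x u) := by
    intro k y hF i hi u hu
    by_cases h : ∃ l < i, u = y l
    · obtain ⟨l, hl, rfl⟩ := h
      exact Or.inl ⟨l, hl, rfl, sh_x k y hF i hi l hl, hF.2.2.2 l (by omega)⟩
    · push Not at h
      right
      have hui : u ≠ y i := fun e => hu.2.1 ⟨rfl, e⟩
      have hall : ∀ l ≤ i, u ≠ y l := by
        intro l hl
        rcases hl.lt_or_eq with h' | h'
        · exact h l h'
        · rw [h']; exact hui
      refine ⟨hall, sh_x' k y hF i hi u hu.1.ne.symm h, adj0 u hu.1 ?_⟩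
      rw [← hF.2.2.1]; exact hall 0 (by omega)
  -- colours at v ≠ x
  have case_o : ∀ k y, Fan k y → ∀ i ≤ k, ∀ v u, v ≠ x → (delE G x (y i)).Adj v u →
      (u = x ∧ (∃ l < i, v = y l) ∧ sh y i v u = b v) ∨
      ((u = x → ∀ l ≤ i, v ≠ y l) ∧ sh y i v u = c v u ∧ (delE G x y0).Adj v u) := by
    intro k y hF i hi v u hv hu
    by_cases hux : u = x
    · subst hux
      rcases case_x k y hF i hi v hu.symm with ⟨l, h1, h2, h3, h4⟩ | ⟨h1, h2, h3⟩
      · left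
        refine ⟨rfl, ⟨l, h1, h2⟩, ?_⟩
        rw [sh_symm k y hF i hi, h3, h2]
      · right
        refine ⟨fun _ => h1, ?_, h3.symm⟩
        rw [sh_symm k y hF i hi, h2, hc.1]
    · right
      exact ⟨fun h => absurd h hux, sh_o _ _ _ _ hv hux, adjo _ _ hu.1 hv hux⟩
  have sh_pc : ∀ k y, Fan k y → ∀ i ≤ k, PC (delE G x (y i)) (sh y i) := by
    intro k y hF i hi
    refine ⟨sh_symm k y hF i hi, ?_⟩
    intro v u w hu hw h
    by_cases hv : v = x
    · subst hv
      rcases case_x k y hF i hi u hu with ⟨l, h1, h2, h3, h4⟩ | ⟨h1, h2, h3⟩ <;>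
      rcases case_x k y hF i hi w hw with ⟨m, k1, k2, k3, k4⟩ | ⟨k1, k2, k3⟩
      · have e : c v (y (l+1)) = c v (y (m+1)) := by rw [h4, k4, ← h3, ← k3, h]
        have e2 := hc.2 v _ _ (adjfan k y hF (l+1) (by omega) (by omega))
          (adjfan k y hF (m+1) (by omega) (by omega)) e
        have := hF.1 (show l+1 ∈ Set.Iic k by simp; omega) (show m+1 ∈ Set.Iic k by simp; omega) e2
        have : l = m := by omega
        rw [h2, k2, this]
      · have e : c v (y (l+1)) = c v w := by rw [h4, ← h3, ← k2, h]
        have e2 := hc.2 v _ _ (adjfan k y hF (l+1) (by omega) (by omega)) k3 e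
        exact absurd e2.symm (k1 (l+1) (by omega))
      · have e : c v (y (m+1)) = c v u := by rw [k4, ← k3, ← h2, h]
        have e2 := hc.2 v _ _ (adjfan k y hF (m+1) (by omega) (by omega)) h3 e
        exact absurd e2.symm (h1 (m+1) (by omega))
      · rw [h2, k2] at h
        exact hc.2 v u w h3 k3 h
    · rcases case_o k y hF i hi v u hv hu with ⟨h1, h2, h3⟩ | ⟨h1, h2, h3⟩ <;>
      rcases case_o k y hF i hi v w hv hw with ⟨k1, k2, k3⟩ | ⟨k1, k2, k3⟩
      · rw [h1, k1]
      · rw [h3, k2] at h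
        exact absurd h.symm (hbm v w k3)
      · rw [h2, k3] at h
        exact absurd h (hbm v u h3)
      · rw [h2, k2] at h
        exact hc.2 v u w h3 k3 h
  have sh_le : ∀ k y, Fan k y → ∀ i ≤ k, ∀ u v, (delE G x (y i)).Adj u v → sh y i u v ≤ d := by
    intro k y hF i hi u v huv
    simp only [sh]
    split_ifs with h1 h2
    · exact hb _
    · exact hb _
    · by_cases hu : u = x
      · subst hu
        rcases case_x k y hF i hi v huv with ⟨l, h1', h2, h3, h4⟩ | ⟨_, _, h3⟩
        · exact absurd ⟨rfl, l, h1', h2⟩ h1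
        · exact hd _ _ h3
      · rcases case_o k y hF i hi u v hu huv with ⟨h1', h2', h3⟩ | ⟨_, _, h3⟩
        · exact absurd ⟨h1', h2'⟩ h2
        · exact hd _ _ h3
  -- missing colours
  have sh_mx : ∀ k y, Fan k y → ∀ i ≤ k, ∀ u, (delE G x (y i)).Adj x u → sh y i x u ≠ a := by
    intro k y hF i hi u hu
    rcases case_x k y hF i hi u hu with ⟨l, h1, h2, h3, h4⟩ | ⟨h1, h2, h3⟩
    · rw [h3, ← h4]
      exact hbm x _ (adjfan k y hF (l+1) (by omega) (by omega))
    · rw [h2]; exact hbm x _ h3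
  have sh_my : ∀ k y, Fan k y → ∀ i ≤ k, ∀ u, (delE G x (y i)).Adj (y i) u →
      sh y i (y i) u ≠ b (y i) := by
    intro k y hF i hi u hu
    have hne : y i ≠ x := (hF.2.1 i hi).ne.symm
    rcases case_o k y hF i hi (y i) u hne hu with ⟨h1, h2, h3⟩ | ⟨h1, h2, h3⟩
    · exact absurd ⟨rfl, h1⟩ hu.2.2
    · rw [h2]; exact hbm _ _ h3
  have tc : ∀ k y (hF : Fan k y) i (hi : i ≤ k) (e : ℕ),
      twoCol G (sh y i) (sh_symm k y hF i hi) x a e = twoCol G c hc.1 x a e := by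
    intro k y hF i hi e
    ext u v
    simp only [twoCol]
    constructor
    · rintro ⟨h1, h2, h3, h4⟩
      rw [sh_o _ _ _ _ h2 h3] at h4
      exact ⟨h1, h2, h3, h4⟩
    · rintro ⟨h1, h2, h3, h4⟩
      rw [← sh_o y i _ _ h2 h3] at h4
      exact ⟨h1, h2, h3, h4⟩
  have claim : ∀ k y, Fan k y → ∀ i ≤ k, ∃ z, (delE G x (y i)).Adj x z ∧ sh y i x z = b (y i) ∧
      (twoCol G c hc.1 x a (b (y i))).Reachable (y i) z := by
    intro k y hF i hi
    have := kempe_claim G d x (y i) (hF.2.1 i hi) hno (sh y i) (sh_pc k y hF i hi)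
      (sh_le k y hF i hi) a (b (y i)) (hb x) (hb _) (sh_mx k y hF i hi) (sh_my k y hF i hi)
    rw [tc k y hF i hi] at this
    exact this
  -- a fan can always be extended
  have ext : ∀ k, ∃ y, Fan k y := by
    intro k
    induction k with
    | zero =>
      refine ⟨fun _ => y0, ?_, ?_, rfl, ?_⟩
      · intro i hi j hj _
        simp only [Set.mem_Iic, Nat.le_zero] at hi hj
        rw [hi, hj]
      · intro i _; exact hxy
      · intro i hi; omega
    | succ k ih =>
      obtain ⟨y, hF⟩ := ih
      obtain ⟨z, hz1, hz2, hz3⟩ := claim k y hF k le_rfl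
      rcases case_x k y hF k le_rfl z hz1 with ⟨l, h1, h2, h3, h4⟩ | ⟨h1, h2, h3⟩
      · exfalso
        have hbe : b (y k) = b (y l) := by rw [← hz2, h3]
        -- second reachability
        obtain ⟨z', w1, w2, w3⟩ := claim k y hF l (by omega)
        have hadj : (delE G x (y l)).Adj x (y (l+1)) := by
          refine ⟨hF.2.1 _ (by omega), ?_, ?_⟩
          · rintro ⟨_, e⟩
            have := hF.1 (show l+1 ∈ Set.Iic k by simp; omega) (show l ∈ Set.Iic k by simp; omega) e
            omega
          · rintro ⟨e, _⟩
            exact (hF.2.1 l (by omega)).ne e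
        have hval : sh y l x (y (l+1)) = b (y l) := by
          rw [sh_x' k y hF l (by omega) _ (hF.2.1 _ (by omega)).ne.symm, h4]
          intro m hm e
          have := hF.1 (show l+1 ∈ Set.Iic k by simp; omega) (show m ∈ Set.Iic k by simp; omega) e
          omega
        have hz' : z' = y (l+1) :=
          (sh_pc k y hF l (by omega)).2 x _ _ w1 hadj (by rw [w2, hval])
        subst hz'
        rw [h2, hbe] at hz3
        -- degrees
        have hinj : ∀ v, v ≠ x → Set.InjOn (c v) ((twoCol G c hc.1 x a (b (y l))).neighborSet v) := by
          intro v hv u hu w hw h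
          exact hc.2 v u w (adjo _ _ hu.1 hu.2.1 hu.2.2.1) (adjo _ _ hw.1 hw.2.1 hw.2.2.1) h
        have hdeg2 : ∀ v, ((twoCol G c hc.1 x a (b (y l))).neighborSet v).ncard ≤ 2 := by
          intro v
          by_cases hv : v = x
          · have : (twoCol G c hc.1 x a (b (y l))).neighborSet v = ∅ := by
              ext u
              simp only [SimpleGraph.mem_neighborSet, Set.mem_empty_iff_false, iff_false]
              intro h; exact h.2.1 hv
            rw [this]; simp
          · rw [← (hinj v hv).ncard_image]
            refine le_trans (Set.ncard_le_ncard (t := {a, b (y l)}) ?_ (Set.toFinite _))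
              ((Set.ncard_insert_le _ _).trans (by rw [Set.ncard_singleton]))
            rintro _ ⟨u, hu, rfl⟩
            exact hu.2.2.2
        have hdeg1 : ∀ v, v ≠ x → (∀ u, u ≠ x → G.Adj v u → c v u ≠ b (y l)) →
            ((twoCol G c hc.1 x a (b (y l))).neighborSet v).ncard ≤ 1 := by
          intro v hv hvb
          rw [← (hinj v hv).ncard_image]
          refine le_trans (Set.ncard_le_ncard (t := {a}) ?_ (Set.toFinite _))
              (Set.ncard_singleton _).le
          rintro _ ⟨u, hu, rfl⟩
          rcases hu.2.2.2 with h | h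
          · exact h
          · exact absurd h (hvb u hu.2.2.1 hu.1)
        have hlk : l + 1 ≠ k := by
          intro e
          have e2 := hbm (y k) x (adjfan k y hF k le_rfl (by omega)).symm
          apply e2
          rw [hc.1, hbe, ← h4, e]
        have nx : ∀ i ≤ k, y i ≠ x := fun i hi => (hF.2.1 i hi).ne.symm
        have ndist : ∀ i ≤ k, ∀ j ≤ k, i ≠ j → y i ≠ y j := fun i hi j hj hij e =>
          hij (hF.1 hi hj e)
        refine three_ends (twoCol G c hc.1 x a (b (y l))) hdeg2
          (ndist l (by omega) (l+1) (by omega) (by omega)) (ndist l (by omega) k le_rfl (by omega))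
          (ndist (l+1) (by omega) k le_rfl hlk)
          (hdeg1 _ (nx l (by omega)) ?_) (hdeg1 _ (nx (l+1) (by omega)) ?_)
          (hdeg1 _ (nx k le_rfl) ?_) w3 hz3.symm
        · intro u hu huv
          exact hbm _ _ (adjo _ _ huv (nx l (by omega)) hu)
        · intro u hu huv e
          have h5 := adjfan k y hF (l+1) (by omega) (by omega)
          refine hu (hc.2 (y (l+1)) u x (adjo _ _ huv (nx _ (by omega)) hu) h5.symm ?_)
          rw [e, hc.1, h4]
        · intro u hu huv
          rw [← hbe]
          exact hbm _ _ (adjo _ _ huv (nx k le_rfl) hu)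
      · refine ⟨fun i => if i ≤ k then y i else z, ?_, ?_, ?_, ?_⟩
        · intro i hi j hj hij
          simp only [Set.mem_Iic] at hi hj hij
          split_ifs at hij with g1 g2 g2
          · exact hF.1 g1 g2 hij
          · exact absurd hij.symm (h1 i g1)
          · exact absurd hij (h1 j g2)
          · omega
        · intro i hi
          simp only
          split_ifs with g
          · exact hF.2.1 i g
          · exact hz1.1
        · simp [hF.2.2.1]
        · intro i hi
          simp only
          rw [if_pos (show i ≤ k by omega)]
          split_ifs with g
          · exact hF.2.2.2 i (by omega)
          · have : i = k := by omega
            rw [this, ← h2, hz2]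
  obtain ⟨y, hF⟩ := ext (Fintype.card V)
  have h1 : Set.ncard (y '' Set.Iic (Fintype.card V)) = Fintype.card V + 1 := by
    rw [hF.1.ncard_image, ← Finset.coe_Iic, Set.ncard_coe_finset]; simp
  have h2 : Set.ncard (y '' Set.Iic (Fintype.card V)) ≤ Fintype.card V := by
    rw [← Nat.card_eq_fintype_card, ← Set.ncard_univ]
    exact Set.ncard_le_ncard (Set.subset_univ _) (Set.toFinite _)
  omega

theorem vizing {V : Type*} [Fintype V] (d : ℕ) (G : SimpleGraph V)
    (hdeg : ∀ v, (G.neighborSet v).ncard ≤ d) :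
    ∃ c, PC G c ∧ ∀ u v, G.Adj u v → c u v ≤ d := by
  induction G using WellFoundedLT.induction with
  | _ G ih =>
  by_cases h : ∃ x y, G.Adj x y
  · obtain ⟨x, y, hxy⟩ := h
    obtain ⟨c, h1, h2⟩ := ih (delE G x y) (by
      refine lt_of_le_of_ne (fun u v h => h.1) ?_
      intro e
      rw [← e] at hxy
      exact hxy.2.1 ⟨rfl, rfl⟩) (fun v => (delE_le G x y v).trans (hdeg v))
    exact vizing_step G d hdeg x y hxy c h1 h2
  · push Not at h
    exact ⟨fun _ _ => 0, ⟨fun _ _ => rfl, fun v u _ hu _ _ => absurd hu (h v u)⟩,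
      fun u v _ => Nat.zero_le _⟩
theorem pc_of_proper {V : Type*} {G : SimpleGraph V} {f : Sym2 V → ℕ}
    (hf : IsProperEdgeColoring G f) : PC G (fun u v => f s(u, v)) := by
  refine ⟨fun u v => by simp only [Sym2.eq_swap], ?_⟩
  intro v u w hu hw h
  by_contra hne
  refine hf s(v, u) hu s(v, w) hw ?_ ⟨v, by simp, by simp⟩ h
  intro e
  exact hne (Sym2.congr_right.mp e)

theorem pal_eq_palette {V : Type*} (G : SimpleGraph V) (f : Sym2 V → ℕ) (v : V) :
    palette G f v = pal G (fun u w => f s(u, w)) v := by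
  ext k
  simp only [palette, pal, Set.mem_ofPred_eq]
  constructor
  · rintro ⟨e, he, hv, hk⟩
    obtain ⟨u, rfl⟩ := Sym2.mem_iff_exists.mp hv
    exact ⟨u, he, hk⟩
  · rintro ⟨u, hu, hk⟩
    exact ⟨s(v, u), hu, by simp, hk⟩

theorem proper_of_pc {V : Type*} {G : SimpleGraph V} {c : V → V → ℕ} (hc : PC G c) :
    IsProperEdgeColoring G (Sym2.lift ⟨c, hc.1⟩) := by
  rintro e₁ h1 e₂ h2 hne ⟨v, hv1, hv2⟩ h
  obtain ⟨u, rfl⟩ := Sym2.mem_iff_exists.mp hv1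
  obtain ⟨w, rfl⟩ := Sym2.mem_iff_exists.mp hv2
  apply hne
  rw [hc.2 v u w h1 h2 h]

theorem paletteIndex_le {V : Type*} {G : SimpleGraph V} {c : V → V → ℕ} (hc : PC G c)
    (X : Set (Set ℕ)) (hX : X.Finite) (h : ∀ v, pal G c v ∈ X) : paletteIndex G ≤ X.ncard := by
  have h1 : paletteIndex G ≤ numPalettes G (Sym2.lift ⟨c, hc.1⟩) :=
    Nat.sInf_le ⟨_, proper_of_pc hc, rfl⟩
  refine h1.trans (Set.ncard_le_ncard ?_ hX)
  rintro _ ⟨v, rfl⟩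
  rw [pal_eq_palette]
  exact h v

theorem exists_proper {V : Type*} [Fintype V] (G : SimpleGraph V) :
    ∃ f, IsProperEdgeColoring G f := by
  obtain ⟨c, hc, _⟩ := vizing (Fintype.card V) G (fun v => by
    rw [← Nat.card_eq_fintype_card, ← Set.ncard_univ]
    exact Set.ncard_le_ncard (Set.subset_univ _) (Set.toFinite _))
  exact ⟨_, proper_of_pc hc⟩

/-- Layered coloring of the product. -/
def lay {V : Type*} (s : ℕ) (F : ℕ → V → V → ℕ) (W : ℕ → V → ℕ) (p q : Fin s × V) : ℕ :=
  if p.1 = q.1 then F p.1 p.2 q.2 else if p.1 < q.1 then W p.1 p.2 else W q.1 q.2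

/-- Palette of the layered coloring. -/
def layPal {V : Type*} (G : SimpleGraph V) (s : ℕ) (F : ℕ → V → V → ℕ) (W : ℕ → V → ℕ)
    (i : ℕ) (v : V) : Set ℕ :=
  {k | k ∈ pal G (F i) v ∨ (i + 1 < s ∧ k = W i v) ∨ (0 < i ∧ k = W (i - 1) v)}

theorem lay_nbr {V : Type*} (G : SimpleGraph V) (s : ℕ) (F : ℕ → V → V → ℕ) (W : ℕ → V → ℕ)
    (p q : Fin s × V) (h : (pathGraph s □ G).Adj p q) :
    (p.1 = q.1 ∧ G.Adj p.2 q.2 ∧ lay s F W p q = F p.1 p.2 q.2) ∨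
    (p.1.val + 1 = q.1.val ∧ q.2 = p.2 ∧ lay s F W p q = W p.1 p.2) ∨
    (q.1.val + 1 = p.1.val ∧ q.2 = p.2 ∧ lay s F W p q = W (p.1.val - 1) p.2) := by
  rw [boxProd_adj, pathGraph_adj] at h
  rcases h with ⟨h1 | h1, h2⟩ | ⟨h1, h2⟩
  · right; left
    have e1 : p.1 ≠ q.1 := by intro e; rw [e] at h1; omega
    have e2 : p.1 < q.1 := by rw [Fin.lt_def]; omega
    exact ⟨h1, h2.symm, by simp [lay, e1, e2]⟩
  · right; right
    have e1 : p.1 ≠ q.1 := by intro e; rw [e] at h1; omega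
    have e2 : ¬ p.1 < q.1 := by rw [Fin.lt_def]; omega
    refine ⟨h1, h2.symm, ?_⟩
    rw [← h1, h2]
    simp [lay, e1, e2]
  · left
    exact ⟨h2, h1, by simp [lay, h2]⟩

theorem lay_pc {V : Type*} (G : SimpleGraph V) (s : ℕ) (F : ℕ → V → V → ℕ) (W : ℕ → V → ℕ)
    (hF : ∀ i < s, PC G (F i)) (h1 : ∀ i, i + 1 < s → ∀ v, W i v ∉ pal G (F i) v)
    (h2 : ∀ i, i + 1 < s → ∀ v, W i v ∉ pal G (F (i + 1)) v)
    (h3 : ∀ i, i + 2 < s → ∀ v, W i v ≠ W (i + 1) v) :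
    PC (pathGraph s □ G) (lay s F W) := by
  constructor
  · intro p q
    simp only [lay]
    rcases lt_trichotomy p.1 q.1 with h | h | h
    · simp [h.ne, h.ne', h, h.not_gt]
    · simp [h, (hF q.1 q.1.2).1 p.2 q.2]
    · simp [h.ne, h.ne', h, h.not_gt]
  · intro p q r hq hr h
    have hp := p.1.2
    have hq' := q.1.2
    have hr' := r.1.2
    have hA : ∀ u, G.Adj p.2 u → F p.1 p.2 u ∈ pal G (F p.1) p.2 := fun u hu => ⟨u, hu, rfl⟩
    have hD : ∀ j, j + 1 = p.1.val → W (p.1.val - 1) p.2 ∉ pal G (F p.1) p.2 := by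
      intro j hj
      have := h2 j (by omega) p.2
      rw [hj] at this
      rwa [show p.1.val - 1 = j by omega]
    have hE : ∀ j, j + 1 = p.1.val → p.1.val + 1 < s → W (p.1.val - 1) p.2 ≠ W p.1 p.2 := by
      intro j hj hs
      have := h3 j (by omega) p.2
      rw [hj] at this
      rwa [show p.1.val - 1 = j by omega]
    rcases lay_nbr G s F W p q hq with ⟨a1, a2, a3⟩ | ⟨a1, a2, a3⟩ | ⟨a1, a2, a3⟩ <;>
    rcases lay_nbr G s F W p r hr with ⟨b1, b2, b3⟩ | ⟨b1, b2, b3⟩ | ⟨b1, b2, b3⟩ <;>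
    rw [a3, b3] at h
    · exact Prod.ext (a1.symm.trans b1) ((hF p.1 hp).2 _ _ _ a2 b2 h)
    · exact absurd (h ▸ hA _ a2) (h1 p.1 (by omega) p.2)
    · exact absurd (h ▸ hA _ a2) (hD _ b1)
    · exact absurd (h ▸ hA _ b2) (h1 p.1 (by omega) p.2)
    · exact Prod.ext (Fin.ext (by omega)) (a2.trans b2.symm)
    · exact absurd h.symm (hE _ b1 (by omega))
    · exact absurd (h ▸ hA _ b2) (hD _ a1)
    · exact absurd h (hE _ a1 (by omega))
    · exact Prod.ext (Fin.ext (by omega)) (a2.trans b2.symm)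

theorem lay_pal {V : Type*} (G : SimpleGraph V) (s : ℕ) (F : ℕ → V → V → ℕ) (W : ℕ → V → ℕ)
    (p : Fin s × V) : pal (pathGraph s □ G) (lay s F W) p = layPal G s F W p.1 p.2 := by
  ext k
  have hp := p.1.2
  constructor
  · rintro ⟨q, hq, rfl⟩
    have hq' := q.1.2
    rcases lay_nbr G s F W p q hq with ⟨a1, a2, a3⟩ | ⟨a1, a2, a3⟩ | ⟨a1, a2, a3⟩
    · left; exact ⟨q.2, a2, a3.symm⟩
    · right; left; exact ⟨by omega, a3⟩
    · right; right; exact ⟨by omega, a3⟩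
  · have mk : ∀ q, (pathGraph s □ G).Adj p q →
      lay s F W p q ∈ pal (pathGraph s □ G) (lay s F W) p := fun q hq => ⟨q, hq, rfl⟩
    rintro (⟨u, hu, rfl⟩ | ⟨h1, rfl⟩ | ⟨h1, rfl⟩)
    · refine ⟨(p.1, u), ?_, ?_⟩
      · rw [boxProd_adj]; exact Or.inr ⟨hu, rfl⟩
      · simp [lay]
    · have hadj : (pathGraph s □ G).Adj p (⟨p.1.val + 1, h1⟩, p.2) := by
        rw [boxProd_adj, pathGraph_adj]; exact Or.inl ⟨Or.inl rfl, rfl⟩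
      refine ⟨_, hadj, ?_⟩
      rcases lay_nbr G s F W p _ hadj with ⟨a1, a2, a3⟩ | ⟨a1, a2, a3⟩ | ⟨a1, a2, a3⟩
      · exact absurd rfl a2.ne
      · exact a3
      · simp only at a1; omega
    · have hadj : (pathGraph s □ G).Adj p (⟨p.1.val - 1, by omega⟩, p.2) := by
        rw [boxProd_adj, pathGraph_adj]
        exact Or.inl ⟨Or.inr (by simp only; omega), rfl⟩
      refine ⟨_, hadj, ?_⟩
      rcases lay_nbr G s F W p _ hadj with ⟨a1, a2, a3⟩ | ⟨a1, a2, a3⟩ | ⟨a1, a2, a3⟩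
      · exact absurd rfl a2.ne
      · simp only at a1; omega
      · exact a3

theorem two_le {V : Type*} [Fintype V] (G : SimpleGraph V) (s : ℕ) (hs : 3 ≤ s) (v : V) :
    2 ≤ paletteIndex (pathGraph s □ G) := by
  apply le_csInf
  · obtain ⟨f, hf⟩ := exists_proper (pathGraph s □ G)
    exact ⟨_, f, hf, rfl⟩
  rintro _ ⟨f, hf, rfl⟩
  have hc := pc_of_proper hf
  have hcard : ∀ p, (palette (pathGraph s □ G) f p).ncard =
      ((pathGraph s □ G).neighborSet p).ncard := by
    intro p
    rw [pal_eq_palette]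
    have hinj : Set.InjOn (fun q => f s(p, q)) ((pathGraph s □ G).neighborSet p) :=
      fun u hu w hw h => hc.2 p u w hu hw h
    rw [← hinj.ncard_image]
    rfl
  let i0 : Fin s := ⟨0, by omega⟩
  let i1 : Fin s := ⟨1, by omega⟩
  let i2 : Fin s := ⟨2, by omega⟩
  have h01 : i0 ≠ i1 := by simp [i0, i1]
  have h02 : i2 ≠ i0 := by simp [i0, i2]
  have h12 : i2 ≠ i1 := by simp [i1, i2]
  let φ : Fin s × V → Fin s × V := Prod.map (Equiv.swap i0 i1) id
  have hφ : Function.Injective φ := (Equiv.injective _).prodMap Function.injective_id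
  have hlt : ((pathGraph s □ G).neighborSet (i0, v)).ncard <
      ((pathGraph s □ G).neighborSet (i1, v)).ncard := by
    rw [← Set.ncard_image_of_injective _ hφ]
    apply Set.ncard_lt_ncard _ (Set.toFinite _)
    rw [Set.ssubset_iff_of_subset]
    · refine ⟨(i2, v), ?_, ?_⟩
      · rw [mem_neighborSet, boxProd_adj, pathGraph_adj]
        exact Or.inl ⟨Or.inl rfl, rfl⟩
      · rintro ⟨⟨j, u⟩, hq, he⟩
        simp only [φ, Prod.map, Prod.mk.injEq, id] at he
        have hj : j = i2 := by
          have := congrArg (Equiv.swap i0 i1) he.1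
          rw [Equiv.swap_apply_self, Equiv.swap_apply_of_ne_of_ne h02 h12] at this
          exact this
        subst hj
        rw [mem_neighborSet, boxProd_adj, pathGraph_adj] at hq
        rcases hq with ⟨h | h, _⟩ | ⟨_, h⟩
        · simp [i0, i2] at h
        · simp [i0, i2] at h
        · exact h02 h.symm
    · rintro _ ⟨⟨j, u⟩, hq, rfl⟩
      rw [mem_neighborSet, boxProd_adj, pathGraph_adj] at hq ⊢
      simp only [φ, Prod.map, id] at hq ⊢
      rcases hq with ⟨h | h, h'⟩ | ⟨h, h'⟩
      · have : j = i1 := Fin.ext (by simp [i0] at h; simp [i1]; omega)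
        subst this
        rw [Equiv.swap_apply_right]
        exact Or.inl ⟨Or.inr rfl, h'⟩
      · simp [i0] at h
      · rw [← h', Equiv.swap_apply_left]
        exact Or.inr ⟨h, rfl⟩
  have hne : palette (pathGraph s □ G) f (i0, v) ≠ palette (pathGraph s □ G) f (i1, v) := by
    intro e
    have := congrArg Set.ncard e
    rw [hcard, hcard] at this
    omega
  unfold numPalettes
  rw [← Set.ncard_pair hne]
  apply Set.ncard_le_ncard _ (Set.finite_range _)
  rintro _ (rfl | rfl)
  · exact ⟨_, rfl⟩
  · exact ⟨_, rfl⟩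

theorem pal_ncard {V : Type*} (G : SimpleGraph V) (c : V → V → ℕ) (hc : PC G c) (v : V) :
    (pal G c v).ncard = (G.neighborSet v).ncard := by
  have hinj : Set.InjOn (c v) (G.neighborSet v) := fun u hu w hw h => hc.2 v u w hu hw h
  rw [← hinj.ncard_image]
  rfl

theorem pal_full {V : Type*} [Fintype V] (G : SimpleGraph V) (c : V → V → ℕ) (hc : PC G c) (r : ℕ)
    (v : V) (hr : (G.neighborSet v).ncard = r) (hd : ∀ u, G.Adj v u → c v u ≤ r)
    (b : ℕ) (hb : b ≤ r) (hbm : b ∉ pal G c v) : insert b (pal G c v) = Set.Iic r := by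
  apply Set.eq_of_subset_of_ncard_le _ _ (Set.finite_Iic r)
  · rintro k (rfl | ⟨u, hu, rfl⟩)
    · exact hb
    · exact hd u hu
  · have hfin : (pal G c v).Finite := (Set.finite_Iic r).subset (by
      rintro k ⟨u, hu, rfl⟩; exact hd u hu)
    rw [Set.ncard_insert_of_notMem hbm hfin, pal_ncard G c hc, hr, ← Finset.coe_Iic,
      Set.ncard_coe_finset]
    simp

theorem pal_full_lt {V : Type*} [Fintype V] (G : SimpleGraph V) (c : V → V → ℕ) (hc : PC G c)
    (r : ℕ) (v : V) (hr : (G.neighborSet v).ncard = r) (hd : ∀ u, G.Adj v u → c v u < r) :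
    pal G c v = Set.Iio r := by
  apply Set.eq_of_subset_of_ncard_le _ _ (Set.finite_Iio r)
  · rintro k ⟨u, hu, rfl⟩
    exact hd u hu
  · rw [pal_ncard G c hc, hr, ← Finset.coe_Iio, Set.ncard_coe_finset]
    simp

theorem insert_Iic (r : ℕ) : insert (r + 1) (Set.Iic r) = Set.Iic (r + 1) := by
  ext k; simp only [Set.mem_insert_iff, Set.mem_Iic]; omega

theorem scheme_even {V : Type*} [Fintype V] (G : SimpleGraph V) (s r : ℕ) (hs : Even s)
    (f : V → V → ℕ) (m : V → ℕ) (hf : PC G f) (hm : ∀ v, m v ∉ pal G f v)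
    (hA : ∀ v, insert (m v) (pal G f v) = Set.Iic r) :
    paletteIndex (pathGraph s □ G) ≤ 2 := by
  have hmr : ∀ v, m v ≤ r := fun v => by
    have : m v ∈ Set.Iic r := by rw [← hA v]; exact Set.mem_insert _ _
    exact this
  have hfr : ∀ v, r + 1 ∉ pal G f v := fun v h => by
    have : r + 1 ∈ Set.Iic r := by rw [← hA v]; exact Set.mem_insert_of_mem _ h
    simp at this
  let F : ℕ → V → V → ℕ := fun _ => f
  let W : ℕ → V → ℕ := fun i v => if Even i then m v else r + 1
  have hW : ∀ i v, W i v ∉ pal G f v := by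
    intro i v; simp only [W]; split_ifs
    · exact hm v
    · exact hfr v
  have hpc : PC (pathGraph s □ G) (lay s F W) := by
    refine lay_pc G s F W (fun _ _ => hf) (fun i _ v => hW i v) (fun i _ v => hW i v) ?_
    intro i _ v
    have := hmr v
    simp only [W, Nat.even_add_one]
    split_ifs <;> omega
  refine (paletteIndex_le hpc {Set.Iic r, Set.Iic (r + 1)} (Set.toFinite _) ?_).trans
    ((Set.ncard_insert_le _ _).trans (by rw [Set.ncard_singleton]))
  intro p
  have hp := p.1.2
  rw [lay_pal]
  have hA' : ∀ k v, (k = m v ∨ k ∈ pal G f v) ↔ k ≤ r := by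
    intro k v
    have := Set.ext_iff.mp (hA v) k
    simpa using this
  rw [Nat.even_iff] at hs
  have key := fun k => hA' k p.2
  have hodd : ∀ i : ℕ, 0 < i → (Even (i - 1) ↔ ¬ Even i) := by
    intro i hi; rw [Nat.even_iff, Nat.even_iff]; omega
  simp only [Set.mem_insert_iff, Set.mem_singleton_iff]
  by_cases hends : p.1.val = 0 ∨ p.1.val + 1 = s
  · left
    ext k
    rw [Set.mem_Iic, ← key k]
    simp only [layPal, Set.mem_ofPred_eq, F, W]
    rcases hends with h | h
    · simp only [h]
      have : 0 + 1 < s := by omega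
      simp [this, or_comm]
    · have h1 : ¬ (p.1.val + 1 < s) := by omega
      have h2 : 0 < p.1.val := by omega
      have h3 : Even (p.1.val - 1) := by rw [Nat.even_iff]; omega
      simp [h1, h2, h3, or_comm]
  · right
    have h1 : p.1.val + 1 < s := by omega
    have h2 : 0 < p.1.val := by omega
    ext k
    have e : k ∈ Set.Iic (r + 1) ↔ (k = r + 1 ∨ k ≤ r) := by simp; omega
    rw [e, ← key k]
    simp only [layPal, Set.mem_ofPred_eq, F, W, hodd _ h2, h1, h2, true_and]
    split_ifs <;> tauto

theorem scheme_odd {V : Type*} [Fintype V] (G : SimpleGraph V) (s r : ℕ) (hs3 : 3 ≤ s) (hs : Odd s)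
    (f g h : V → V → ℕ) (m w : V → ℕ) (hf : PC G f) (hg : PC G g) (hh : PC G h)
    (hm : ∀ v, m v ∉ pal G f v) (hA : ∀ v, insert (m v) (pal G f v) = Set.Iic r)
    (hmg : ∀ v, m v ∉ pal G g v) (hwm : ∀ v, m v ≠ w v) (hwg : ∀ v, w v ∉ pal G g v)
    (hwh : ∀ v, w v ∉ pal G h v) (X : Set (Set ℕ)) (hX : X.Finite) (hX1 : Set.Iic r ∈ X)
    (hX2 : Set.Iic (r + 1) ∈ X) (hX3 : ∀ v, insert (w v) (insert (m v) (pal G g v)) ∈ X)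
    (hX4 : ∀ v, insert (w v) (pal G h v) ∈ X) :
    paletteIndex (pathGraph s □ G) ≤ X.ncard := by
  have hmr : ∀ v, m v ≤ r := fun v => by
    have : m v ∈ Set.Iic r := by rw [← hA v]; exact Set.mem_insert _ _
    exact this
  have hfr : ∀ v, r + 1 ∉ pal G f v := fun v h => by
    have : r + 1 ∈ Set.Iic r := by rw [← hA v]; exact Set.mem_insert_of_mem _ h
    simp at this
  rw [Nat.odd_iff] at hs
  let F : ℕ → V → V → ℕ := fun i => if i + 2 < s then f else if i + 1 < s then g else h
  let W : ℕ → V → ℕ := fun i v => if i + 2 < s then (if Even i then m v else r + 1) else w v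
  have Ff : ∀ i, i + 2 < s → F i = f := fun i hi => if_pos hi
  have Fg : F (s - 2) = g := by
    simp only [F]; rw [if_neg (by omega), if_pos (by omega)]
  have Fh : F (s - 1) = h := by
    simp only [F]; rw [if_neg (by omega), if_neg (by omega)]
  have Wm : ∀ i v, i + 2 < s → i % 2 = 0 → W i v = m v := by
    intro i v hi he
    simp only [W]; rw [if_pos hi, if_pos (Nat.even_iff.mpr he)]
  have Wr : ∀ i v, i + 2 < s → i % 2 = 1 → W i v = r + 1 := by
    intro i v hi he
    simp only [W]; rw [if_pos hi, if_neg (by rw [Nat.even_iff]; omega)]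
  have Ww : ∀ v, W (s - 2) v = w v := by
    intro v
    simp only [W]; rw [if_neg (by omega)]
  have hpc : PC (pathGraph s □ G) (lay s F W) := by
    refine lay_pc G s F W ?_ ?_ ?_ ?_
    · intro i _
      simp only [F]; split_ifs <;> assumption
    · intro i hi v
      rcases lt_or_ge (i + 2) s with hi2 | hi2
      · rw [Ff i hi2]
        rcases Nat.mod_two_eq_zero_or_one i with e | e
        · rw [Wm i v hi2 e]; exact hm v
        · rw [Wr i v hi2 e]; exact hfr v
      · obtain rfl : i = s - 2 := by omega
        rw [Fg, Ww]; exact hwg v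
    · intro i hi v
      rcases lt_or_ge (i + 3) s with hi2 | hi2
      · rw [Ff (i+1) (by omega)]
        rcases Nat.mod_two_eq_zero_or_one i with e | e
        · rw [Wm i v (by omega) e]; exact hm v
        · rw [Wr i v (by omega) e]; exact hfr v
      · rcases (show i + 1 = s - 2 ∨ i + 1 = s - 1 by omega) with e | e
        · rw [e, Fg, Wm i v (by omega) (by omega)]; exact hmg v
        · obtain rfl : i = s - 2 := by omega
          rw [e, Fh, Ww]; exact hwh v
    · intro i hi v
      rcases lt_or_ge (i + 3) s with hi2 | hi2
      · have := hmr v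
        rcases Nat.mod_two_eq_zero_or_one i with e | e
        · rw [Wm i v (by omega) e, Wr (i+1) v (by omega) (by omega)]; omega
        · rw [Wr i v (by omega) e, Wm (i+1) v (by omega) (by omega)]; omega
      · rw [show i + 1 = s - 2 by omega, Ww, Wm i v (by omega) (by omega)]
        exact hwm v
  refine paletteIndex_le hpc X hX ?_
  rintro ⟨⟨i, hi⟩, v⟩
  rw [lay_pal]
  simp only
  have key : ∀ k, (k = m v ∨ k ∈ pal G f v) ↔ k ≤ r := by
    intro k
    have := Set.ext_iff.mp (hA v) k
    simpa using this
  rcases (show i = 0 ∨ (0 < i ∧ i + 2 < s) ∨ i = s - 2 ∨ i = s - 1 by omega) with e | e | e | e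
  · convert hX1 using 1
    ext k
    subst e
    simp only [layPal, Set.mem_ofPred_eq, Set.mem_Iic]
    rw [Ff 0 (by omega), Wm 0 v (by omega) rfl, ← key k]
    have : 0 + 1 < s := by omega
    simp [this, or_comm]
  · convert hX2 using 1
    ext k
    have e' : k ∈ Set.Iic (r + 1) ↔ (k = r + 1 ∨ k ≤ r) := by simp; omega
    rw [e', ← key k]
    have e1 : i + 1 < s := by omega
    simp only [layPal, Set.mem_ofPred_eq, e1, e.1, true_and]
    rw [Ff i e.2]
    rcases Nat.mod_two_eq_zero_or_one i with h0 | h0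
    · rw [Wm i v e.2 h0, Wr (i-1) v (by omega) (by omega)]; tauto
    · rw [Wr i v e.2 h0, Wm (i-1) v (by omega) (by omega)]; tauto
  · convert hX3 v using 1
    ext k
    have e1 : i + 1 < s := by omega
    have e2 : 0 < i := by omega
    simp only [layPal, Set.mem_ofPred_eq, e1, e2, true_and, Set.mem_insert_iff]
    rw [Wm (i-1) v (by omega) (by omega), e, Fg, Ww]; tauto
  · convert hX4 v using 1
    ext k
    have e1 : ¬ i + 1 < s := by omega
    have e2 : 0 < i := by omega
    simp only [layPal, Set.mem_ofPred_eq, e1, e2, true_and, false_and, false_or, Set.mem_insert_iff]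
    rw [show i - 1 = s - 2 by omega, e, Fh, Ww]; tauto

theorem pc_comp {V : Type*} {G : SimpleGraph V} {t : V → V → ℕ} (ht : PC G t) (φ : ℕ → ℕ)
    (h : ∀ v, Set.InjOn φ (pal G t v)) : PC G (fun u v => φ (t u v)) := by
  refine ⟨fun u v => by simp only [ht.1 u v], ?_⟩
  intro v u w hu hw e
  exact ht.2 v u w hu hw (h v ⟨u, hu, rfl⟩ ⟨w, hw, rfl⟩ e)

theorem pal_comp {V : Type*} (G : SimpleGraph V) (t : V → V → ℕ) (φ : ℕ → ℕ) (v : V) :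
    pal G (fun u v => φ (t u v)) v = φ '' pal G t v := by
  ext k
  constructor
  · rintro ⟨u, hu, rfl⟩; exact ⟨_, ⟨u, hu, rfl⟩, rfl⟩
  · rintro ⟨_, ⟨u, hu, rfl⟩, rfl⟩; exact ⟨u, hu, rfl⟩

/-- A regular graph has a coloring whose missing colors are known. -/
theorem regular_coloring {V : Type*} [Fintype V] (G : SimpleGraph V) (r : ℕ)
    (hr : IsRegularDeg G r) : ∃ (f : V → V → ℕ) (m : V → ℕ), PC G f ∧ (∀ v, m v ∉ pal G f v) ∧
      (∀ v, insert (m v) (pal G f v) = Set.Iic r) ∧ ∀ v, m v ≤ r := by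
  obtain ⟨f, hf, hd⟩ := vizing r G (fun v => (hr v).le)
  choose m hm hmm using fun v => exists_missing G f r v (hr v).le
  have hm' : ∀ v, m v ∉ pal G f v := fun v ⟨u, hu, e⟩ => hmm v u hu e
  exact ⟨f, m, hf, hm', fun v => pal_full G f hf r v (hr v) (fun u hu => hd v u hu) _ (hm v) (hm' v),
    hm⟩

theorem part_one_odd {V : Type*} [Fintype V] (G : SimpleGraph V) (s r : ℕ) (hs3 : 3 ≤ s)
    (hs : Odd s) (hr : IsRegularDeg G r) :
    paletteIndex (pathGraph s □ G) ≤ paletteIndex G + 2 := by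
  obtain ⟨f, m, hf, hm, hA, hmr⟩ := regular_coloring G r hr
  obtain ⟨f0, hf0, hn⟩ := Nat.sInf_mem (s := {n | ∃ f, IsProperEdgeColoring G f ∧
    numPalettes G f = n}) (by obtain ⟨f, hf⟩ := exists_proper G; exact ⟨_, f, hf, rfl⟩)
  have hc := pc_of_proper hf0
  set c : V → V → ℕ := fun u v => f0 s(u, v) with hcdef
  let φ : ℕ → ℕ := fun k => k + (r + 2)
  have hφ : Function.Injective φ := fun a b h => by simp only [φ] at h; omega
  have hfr : ∀ v, r + 1 ∉ pal G f v := fun v h => by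
    have : r + 1 ∈ Set.Iic r := by rw [← hA v]; exact Set.mem_insert_of_mem _ h
    simp at this
  let Y : Set (Set ℕ) := (fun S => insert (r + 1) (φ '' S)) '' (Set.range (palette G f0))
  have hY : Y.ncard ≤ paletteIndex G := by
    refine (Set.ncard_image_le (Set.finite_range _)).trans ?_
    exact hn.le
  have := scheme_odd G s r hs3 hs f f (fun u v => φ (c u v)) m (fun _ => r + 1) hf hf
    (pc_comp hc φ (fun v => hφ.injOn)) hm hA hm
    (fun v => by have := hmr v; omega) hfr ?_ (insert (Set.Iic r) (insert (Set.Iic (r + 1)) Y))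
    ?_ (Set.mem_insert _ _) (Set.mem_insert_of_mem _ (Set.mem_insert _ _)) ?_ ?_
  · refine this.trans ((Set.ncard_insert_le _ _).trans ?_)
    have := Set.ncard_insert_le (Set.Iic (r+1)) Y
    omega
  · intro v
    rw [pal_comp]
    rintro ⟨k, _, hk⟩
    simp only [φ] at hk
    omega
  · exact (((Set.finite_range _).image _).insert _).insert _
  · intro v
    rw [hA v, insert_Iic]
    exact Set.mem_insert_of_mem _ (Set.mem_insert _ _)
  · intro v
    rw [pal_comp]
    refine Set.mem_insert_of_mem _ (Set.mem_insert_of_mem _ ⟨palette G f0 v, ⟨v, rfl⟩, ?_⟩)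
    rw [pal_eq_palette]

theorem part_two_odd {V : Type*} [Fintype V] (G : SimpleGraph V) (s r : ℕ) (hs3 : 3 ≤ s)
    (hs : Odd s) (hr : IsRegularDeg G r) (hG : G.edgeSet.Nonempty) (h1 : IsClass1 G) :
    paletteIndex (pathGraph s □ G) ≤ 2 := by
  obtain ⟨x, y, hxy⟩ : ∃ x y, G.Adj x y := by
    obtain ⟨e, he⟩ := hG
    induction e with | _ x y => exact ⟨x, y, he⟩
  have hr0 : 0 < r := by
    rw [← hr x]
    exact (Set.ncard_pos (Set.toFinite _)).mpr ⟨y, hxy⟩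
  have hmax : maxDeg G = r := by
    unfold maxDeg
    have : Set.range (vertDegree G) = {r} := by
      ext k
      constructor
      · rintro ⟨v, rfl⟩; exact hr v
      · rintro rfl; exact ⟨x, hr x⟩
    rw [this, csSup_singleton]
  have hmem := Nat.sInf_mem (s := {n | ∃ f, IsProperEdgeColoring G f ∧
    ∀ e ∈ G.edgeSet, f e < n}) (by
      obtain ⟨c, hc, hd⟩ := vizing r G (fun v => (hr v).le)
      refine ⟨r + 1, _, proper_of_pc hc, ?_⟩
      intro e he
      induction e with | _ x y => exact Nat.lt_succ_of_le (hd x y he))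
  have hci : chromIndex G = r := by rw [h1, hmax]
  unfold chromIndex at hci
  rw [hci] at hmem
  obtain ⟨f0, hf0, hlt⟩ := hmem
  have hc := pc_of_proper hf0
  set c : V → V → ℕ := fun u v => f0 s(u, v) with hcdef
  have hpal : ∀ v, pal G c v = Set.Iio r := fun v =>
    pal_full_lt G c hc r v (hr v) (fun u hu => hlt _ hu)
  let φ : ℕ → ℕ := fun k => if k = 0 then r + 1 else k
  let ψ : ℕ → ℕ := fun k => if k = 0 then r else k
  have hφ : ∀ v, pal G (fun u v => φ (c u v)) v = {k | k = r + 1 ∨ (0 < k ∧ k < r)} := by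
    intro v
    rw [pal_comp, hpal v]
    ext k
    simp only [Set.mem_image, Set.mem_Iio, Set.mem_ofPred_eq, φ]
    constructor
    · rintro ⟨j, hj, rfl⟩; split_ifs <;> omega
    · rintro (h | h)
      · exact ⟨0, hr0, by simp [h]⟩
      · exact ⟨k, h.2, by rw [if_neg (by omega)]⟩
  have hψ : ∀ v, pal G (fun u v => ψ (c u v)) v = {k | k = r ∨ (0 < k ∧ k < r)} := by
    intro v
    rw [pal_comp, hpal v]
    ext k
    simp only [Set.mem_image, Set.mem_Iio, Set.mem_ofPred_eq, ψ]
    constructor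
    · rintro ⟨j, hj, rfl⟩; split_ifs <;> omega
    · rintro (h | h)
      · exact ⟨0, hr0, by simp [h]⟩
      · exact ⟨k, h.2, by rw [if_neg (by omega)]⟩
  have hX : ({Set.Iic r, Set.Iic (r + 1)} : Set (Set ℕ)).ncard ≤ 2 :=
    ((Set.ncard_insert_le _ _).trans (by rw [Set.ncard_singleton]))
  refine le_trans (scheme_odd G s r hs3 hs c (fun u v => φ (c u v)) (fun u v => ψ (c u v))
    (fun _ => r) (fun _ => 0) hc (pc_comp hc φ ?_) (pc_comp hc ψ ?_) ?_ ?_ ?_ ?_ ?_ ?_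
    {Set.Iic r, Set.Iic (r + 1)} (Set.toFinite _) (by simp) (by simp) ?_ ?_) hX
  · intro v
    rw [hpal]
    intro a ha b hb h
    simp only [Set.mem_Iio, φ] at ha hb h
    split_ifs at h <;> omega
  · intro v
    rw [hpal]
    intro a ha b hb h
    simp only [Set.mem_Iio, ψ] at ha hb h
    split_ifs at h <;> omega
  · intro v; rw [hpal]; simp
  · intro v; rw [hpal]; ext k; simp only [Set.mem_insert_iff, Set.mem_Iio, Set.mem_Iic]; omega
  · intro v; rw [hφ]; simp
  · intro v; exact hr0.ne'
  · intro v; rw [hφ]; simp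
  · intro v; rw [hψ]; simp; omega
  · intro v; rw [hφ]; right
    ext k; simp; omega
  · intro v; rw [hψ]; left
    ext k; simp; omega
/-- Local edge-type palettes. -/
def kindP : Fin 4 → Finset ℕ := ![{0, 1, 2}, {0, 1, 3}, {0, 3, 4}, {0, 1, 4}]
/-- Missing color of the first layer, by kind. -/
def kindM : Fin 4 → ℕ := ![3, 1, 2, 3]
/-- Color of the last vertical edge, by kind. -/
def kindW : Fin 4 → ℕ := ![2, 2, 4, 5]
/-- Colors of the types in the first layers. -/
def phiF : ℕ → ℕ := fun k => if k = 0 then 0 else if k = 1 then 2 else if k = 3 then 3 else 1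
/-- Colors of the types in the last but one layer. -/
def phiG : ℕ → ℕ := fun k => if k = 0 then 0 else if k = 1 then 4 else if k = 3 then 3 else 1
/-- Colors of the types in the last layer. -/
def phiH : ℕ → ℕ := fun k => if k = 0 then 0 else if k = 1 then 4 else if k = 4 then 2 else 5

open Classical in
theorem exists_types {V : Type*} [Fintype V] (G : SimpleGraph V) (hr : IsRegularDeg G 3)
    (M : Set (Sym2 V)) (hM : IsPerfectMatchingSet G M) :
    ∃ t : V → V → ℕ, PC G t ∧ ∀ v, ∃ k : Fin 4, pal G t v = (kindP k : Set ℕ) := by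
  let H : SimpleGraph V :=
    { Adj := fun u v => G.Adj u v ∧ s(u, v) ∉ M
      symm := ⟨fun u v h => ⟨h.1.symm, by rw [Sym2.eq_swap]; exact h.2⟩⟩
      loopless := ⟨fun u h => h.1.ne rfl⟩ }
  have hMu : ∀ v, ∃ u, G.Adj v u ∧ s(v, u) ∈ M ∧ ∀ w, s(v, w) ∈ M → w = u := by
    intro v
    obtain ⟨e, ⟨he, hv⟩, hu⟩ := hM.2 v
    obtain ⟨u, rfl⟩ := Sym2.mem_iff_exists.mp hv
    refine ⟨u, hM.1 he, he, ?_⟩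
    intro w hw
    exact Sym2.congr_right.mp (hu _ ⟨hw, by simp⟩)
  have hH : ∀ v, (H.neighborSet v).ncard = 2 := by
    intro v
    obtain ⟨u, h1, h2, h3⟩ := hMu v
    have : G.neighborSet v = insert u (H.neighborSet v) := by
      ext w
      simp only [mem_neighborSet, Set.mem_insert_iff]
      constructor
      · intro h
        by_cases hw : s(v, w) ∈ M
        · exact Or.inl (h3 w hw)
        · exact Or.inr ⟨h, hw⟩
      · rintro (rfl | h)
        · exact h1
        · exact h.1
    have h4 := hr v
    unfold vertDegree at h4
    rw [this, Set.ncard_insert_of_notMem (fun h => h.2 h2) (Set.toFinite _)] at h4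
    omega
  obtain ⟨c, b, hc, hbm, hfull, hb⟩ := regular_coloring H 2 hH
  let see : V → Prop := fun v => 2 ∈ pal H c v
  let t : V → V → ℕ := fun u v => if s(u, v) ∈ M then 0 else if c u v = 0 then 1 else
    if c u v = 2 then 3 else if see u ∨ see v then 4 else 2
  have hle : ∀ u v, H.Adj u v → c u v ≤ 2 := by
    intro u v h
    have : c u v ∈ Set.Iic 2 := by
      rw [← hfull u]; exact Set.mem_insert_of_mem _ ⟨v, h, rfl⟩
    exact this
  have tM : ∀ u v, s(u, v) ∈ M → t u v = 0 := fun u v h => if_pos h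
  have tH : ∀ u v, s(u, v) ∉ M → t u v = if c u v = 0 then 1 else
    if c u v = 2 then 3 else if see u ∨ see v then 4 else 2 := fun u v h => if_neg h
  refine ⟨t, ⟨?_, ?_⟩, ?_⟩
  · intro u v
    simp only [t]
    have e : (see u ∨ see v) ↔ (see v ∨ see u) := or_comm
    rw [Sym2.eq_swap, hc.1 u v]
    simp only [e]
  · intro v u w hu hw h
    obtain ⟨x, h1, h2, h3⟩ := hMu v
    by_cases m1 : s(v, u) ∈ M <;> by_cases m2 : s(v, w) ∈ M
    · rw [h3 u m1, h3 w m2]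
    · rw [tM v u m1, tH v w m2] at h
      split_ifs at h
    · rw [tM v w m2, tH v u m1] at h
      split_ifs at h
    · have l1 := hle v u ⟨hu, m1⟩
      have l2 := hle v w ⟨hw, m2⟩
      refine hc.2 v u w ⟨hu, m1⟩ ⟨hw, m2⟩ ?_
      rw [tH v u m1, tH v w m2] at h
      split_ifs at h <;> omega
  · intro v
    obtain ⟨x, h1, h2, h3⟩ := hMu v
    have hpal : pal G t v = insert 0 (pal H t v) := by
      ext k
      constructor
      · rintro ⟨u, hu, rfl⟩
        by_cases m1 : s(v, u) ∈ M
        · left; exact tM v u m1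
        · right; exact ⟨u, ⟨hu, m1⟩, rfl⟩
      · rintro (rfl | ⟨u, hu, rfl⟩)
        · exact ⟨x, h1, tM v x h2⟩
        · exact ⟨u, hu.1, rfl⟩
    have hcol : ∀ k, (k = b v ∨ ∃ u, H.Adj v u ∧ c v u = k) ↔ k ≤ 2 := by
      intro k
      have := Set.ext_iff.mp (hfull v) k
      simpa [pal] using this
    have hex : ∀ k ≤ 2, k ≠ b v → ∃ u, H.Adj v u ∧ c v u = k := by
      intro k hk hne
      rcases (hcol k).mpr hk with h | h
      · exact absurd h hne
      · exact h
    have hne : ∀ u, H.Adj v u → c v u ≠ b v := fun u hu e => hbm v ⟨u, hu, e⟩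
    have hpair : ∀ u w, H.Adj v u → H.Adj v w → c v u ≠ c v w →
        pal H t v = {t v u, t v w} := by
      intro u w hu hw huw
      ext k
      constructor
      · rintro ⟨z, hz, rfl⟩
        have l1 := hle v u hu
        have l2 := hle v w hw
        have l3 := hle v z hz
        have n1 := hne u hu
        have n2 := hne w hw
        have n3 := hne z hz
        have l4 := hb v
        have : c v z = c v u ∨ c v z = c v w := by omega
        rcases this with e | e
        · left; rw [hc.2 v z u hz hu e]
        · right; rw [hc.2 v z w hz hw e]; rfl
      · rintro (rfl | rfl)
        · exact ⟨u, hu, rfl⟩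
        · exact ⟨w, hw, rfl⟩
    have hbv := hb v
    rcases (show b v = 0 ∨ b v = 1 ∨ b v = 2 by omega) with e | e | e
    · obtain ⟨u, hu, hu'⟩ := hex 1 (by omega) (by omega)
      obtain ⟨w, hw, hw'⟩ := hex 2 (by omega) (by omega)
      have hsee : see v := ⟨w, hw, hw'⟩
      have t1 : t v u = 4 := by rw [tH v u hu.2, hu']; simp [hsee]
      have t2 : t v w = 3 := by rw [tH v w hw.2, hw']; simp
      refine ⟨2, ?_⟩
      rw [hpal, hpair u w hu hw (by omega), t1, t2]
      ext k; simp [kindP]; tauto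
    · obtain ⟨u, hu, hu'⟩ := hex 0 (by omega) (by omega)
      obtain ⟨w, hw, hw'⟩ := hex 2 (by omega) (by omega)
      have t1 : t v u = 1 := by rw [tH v u hu.2, hu']; simp
      have t2 : t v w = 3 := by rw [tH v w hw.2, hw']; simp
      refine ⟨1, ?_⟩
      rw [hpal, hpair u w hu hw (by omega), t1, t2]
      ext k; simp [kindP]
    · obtain ⟨u, hu, hu'⟩ := hex 0 (by omega) (by omega)
      obtain ⟨w, hw, hw'⟩ := hex 1 (by omega) (by omega)
      have t1 : t v u = 1 := by rw [tH v u hu.2, hu']; simp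
      by_cases hs : see v ∨ see w
      · have t2 : t v w = 4 := by rw [tH v w hw.2, hw']; simp [hs]
        refine ⟨3, ?_⟩
        rw [hpal, hpair u w hu hw (by omega), t1, t2]
        ext k; simp [kindP]
      · have t2 : t v w = 2 := by rw [tH v w hw.2, hw']; simp [hs]
        refine ⟨0, ?_⟩
        rw [hpal, hpair u w hu hw (by omega), t1, t2]
        ext k; simp [kindP]

theorem part_three {V : Type*} [Fintype V] (G : SimpleGraph V) (s : ℕ) (hs3 : 3 ≤ s)
    (hs : Odd s) (hr : IsRegularDeg G 3) (M : Set (Sym2 V)) (hM : IsPerfectMatchingSet G M) :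
    paletteIndex (pathGraph s □ G) ≤ 4 := by
  obtain ⟨t, ht, hk⟩ := exists_types G hr M hM
  choose k hk using hk
  have inj : ∀ φ : ℕ → ℕ, (∀ j : Fin 4, ∀ a ∈ kindP j, ∀ b ∈ kindP j, φ a = φ b → a = b) →
      ∀ v, Set.InjOn φ (pal G t v) := by
    intro φ h v a ha b hb e
    rw [hk v] at ha hb
    exact h (k v) a ha b hb e
  have hp : ∀ φ : ℕ → ℕ, ∀ v, pal G (fun u v => φ (t u v)) v =
      (((kindP (k v)).image φ : Finset ℕ) : Set ℕ) := by
    intro φ v; rw [pal_comp, hk v, Finset.coe_image]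
  have i3 : Set.Iic 3 = ((({0, 1, 2, 3} : Finset ℕ)) : Set ℕ) := by
    ext x; simp; omega
  have i4 : Set.Iic 4 = ((({0, 1, 2, 3, 4} : Finset ℕ)) : Set ℕ) := by
    ext x; simp; omega
  let X : Finset (Finset ℕ) := {{0, 1, 2, 3}, {0, 1, 2, 3, 4}, {0, 1, 3, 4, 5}, {0, 2, 4, 5}}
  let Y : Set (Set ℕ) := (fun S : Finset ℕ => (S : Set ℕ)) '' (X : Set (Finset ℕ))
  have hY : Y.ncard ≤ 4 := by
    refine (Set.ncard_image_le (Finset.finite_toSet X)).trans ?_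
    rw [Set.ncard_coe_finset]
    exact Finset.card_le_four
  have memY : ∀ S ∈ X, (S : Set ℕ) ∈ Y := fun S hS => ⟨S, hS, rfl⟩
  refine le_trans (scheme_odd G s 3 hs3 hs (fun u v => phiF (t u v)) (fun u v => phiG (t u v))
    (fun u v => phiH (t u v)) (fun v => kindM (k v)) (fun v => kindW (k v))
    (pc_comp ht _ (inj _ (by decide))) (pc_comp ht _ (inj _ (by decide)))
    (pc_comp ht _ (inj _ (by decide))) ?_ ?_ ?_ ?_ ?_ ?_ Y ((Finset.finite_toSet X).image _)
    ?_ ?_ ?_ ?_) hY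
  · intro v; rw [hp, Finset.mem_coe]; generalize k v = j; revert j; decide
  · intro v; rw [hp, ← Finset.coe_insert, i3, Finset.coe_inj]; generalize k v = j; revert j; decide
  · intro v; rw [hp, Finset.mem_coe]; generalize k v = j; revert j; decide
  · intro v; generalize k v = j; revert j; decide
  · intro v; rw [hp, Finset.mem_coe]; generalize k v = j; revert j; decide
  · intro v; rw [hp, Finset.mem_coe]; generalize k v = j; revert j; decide
  · rw [i3]; exact memY _ (by decide)
  · rw [i4]; exact memY _ (by decide)
  · intro v; rw [hp, ← Finset.coe_insert, ← Finset.coe_insert]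
    apply memY; generalize k v = j; revert j; decide
  · intro v; rw [hp, ← Finset.coe_insert]
    apply memY; generalize k v = j; revert j; decide

/-- Let `G` be a finite regular simple graph with at least one edge
and `s ≥ 3`. Then (i) `š(P_s □ G) ≤ š(G) + 2`; (ii) if `s` is even or `G` is
class 1 then `š(P_s □ G) = 2`; (iii) if `G` is a class 2 cubic graph with a
perfect matching and `s` is odd then `š(P_s □ G) ∈ {2, 3, 4}`. -/
theorem paletteIndex_path_boxProd_regular {V : Type*} [Fintype V] (G : SimpleGraph V)
    (s : ℕ) (hs : 3 ≤ s) (hreg : ∃ r, IsRegularDeg G r) (hG : G.edgeSet.Nonempty) :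
    paletteIndex (pathGraph s □ G) ≤ paletteIndex G + 2 ∧
    (Even s ∨ IsClass1 G → paletteIndex (pathGraph s □ G) = 2) ∧
    (IsRegularDeg G 3 ∧ ¬IsClass1 G ∧ (∃ M, IsPerfectMatchingSet G M) ∧ Odd s →
      paletteIndex (pathGraph s □ G) ∈ ({2, 3, 4} : Set ℕ)) := by
  obtain ⟨r, hr⟩ := hreg
  obtain ⟨x⟩ : Nonempty V := by
    obtain ⟨e, he⟩ := hG
    induction e with | _ x y => exact ⟨x⟩
  have h2 := two_le G s hs x
  have heven : Even s → paletteIndex (pathGraph s □ G) ≤ 2 := by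
    intro he
    obtain ⟨f, m, hf, hm, hA, _⟩ := regular_coloring G r hr
    exact scheme_even G s r he f m hf hm hA
  refine ⟨?_, ?_, ?_⟩
  · rcases Nat.even_or_odd s with he | ho
    · exact (heven he).trans (by omega)
    · exact part_one_odd G s r hs ho hr
  · intro h
    refine le_antisymm ?_ h2
    rcases Nat.even_or_odd s with he | ho
    · exact heven he
    · rcases h with h | h
      · exact heven h
      · exact part_two_odd G s r hs ho hr hG h
  · rintro ⟨h3, _, ⟨M, hM⟩, ho⟩
    have h4 := part_three G s hs ho h3 M hM
    simp only [Set.mem_insert_iff, Set.mem_singleton_iff]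
    omega
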